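/- Let G be a proper Helly circular-arc graph and let H be a hole in G. Then every vertex of G has at least two neighbors among the vertices of H. -/

import Mathlib

/-! Common definitions: arc/interval representations, graph classes,
induced subgraph containment, small named graphs, reduced graphs. -/

/-- The point of the unit circle corresponding to parameter `t`. -/
noncomputable def circlePt (t : ℝ) : ℝ × ℝ :=
  (Real.cos (2 * Real.pi * t), Real.sin (2 * Real.pi * t))

/-- A (nonempty closed) arc of the unit circle: the image under
`t ↦ (cos 2πt, sin 2πt)` of a closed interval `[a, b] ⊆ ℝ` with `0 ≤ b - a < 1`. -/
def IsUnitCircleArc (A : Set (ℝ × ℝ)) : Prop :=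
  ∃ a b : ℝ, 0 ≤ b - a ∧ b - a < 1 ∧ A = circlePt '' Set.Icc a b

/-- An arc representation of a graph: each vertex gets an arc of the unit circle,
and two distinct vertices are adjacent iff their arcs intersect. -/
def IsArcRep {V : Type*} (G : SimpleGraph V) (f : V → Set (ℝ × ℝ)) : Prop :=
  (∀ v, IsUnitCircleArc (f v)) ∧
    ∀ u v : V, u ≠ v → (G.Adj u v ↔ (f u ∩ f v).Nonempty)

/-- A family of sets is proper if no member is properly contained in another. -/
def ProperFamily {V α : Type*} (f : V → Set α) : Prop :=
  ∀ u v : V, ¬ f u ⊂ f v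

/-- A family of sets is Helly if every subfamily of pairwise intersecting sets
has a common point. -/
def HellyFamily {V α : Type*} (f : V → Set α) : Prop :=
  ∀ S : Set V, (∀ u ∈ S, ∀ v ∈ S, (f u ∩ f v).Nonempty) → (⋂ v ∈ S, f v).Nonempty

/-- A proper circular-arc graph: admits an arc representation with no arc
properly contained in another. -/
def IsProperCircularArcGraph {V : Type*} (G : SimpleGraph V) : Prop :=
  ∃ f : V → Set (ℝ × ℝ), IsArcRep G f ∧ ProperFamily f

/-- A proper Helly circular-arc graph: admits an arc representation that is
simultaneously proper and Helly. -/
def IsProperHellyCircularArcGraph {V : Type*} (G : SimpleGraph V) : Prop :=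
  ∃ f : V → Set (ℝ × ℝ), IsArcRep G f ∧ ProperFamily f ∧ HellyFamily f

/-- An interval representation: each vertex gets a nonempty closed bounded
interval of ℝ; distinct vertices adjacent iff intervals intersect. -/
def IsIntervalRep {V : Type*} (G : SimpleGraph V) (f : V → Set ℝ) : Prop :=
  (∀ v, ∃ a b : ℝ, a ≤ b ∧ f v = Set.Icc a b) ∧
    ∀ u v : V, u ≠ v → (G.Adj u v ↔ (f u ∩ f v).Nonempty)

def IsIntervalGraph {V : Type*} (G : SimpleGraph V) : Prop :=
  ∃ f : V → Set ℝ, IsIntervalRep G f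

def IsProperIntervalGraph {V : Type*} (G : SimpleGraph V) : Prop :=
  ∃ f : V → Set ℝ, IsIntervalRep G f ∧ ProperFamily f

/-- A graph is bipartite: its vertices can be partitioned into two independent sets. -/
def IsBipartite {V : Type*} (G : SimpleGraph V) : Prop :=
  ∃ c : V → Bool, ∀ u v : V, G.Adj u v → c u ≠ c v

/-- A permutation graph. -/
def IsPermutationGraph {V : Type*} (G : SimpleGraph V) : Prop :=
  ∃ a b : V → ℝ, Function.Injective a ∧ Function.Injective b ∧
    ∀ u v : V, u ≠ v → (G.Adj u v ↔ (a u - a v) * (b u - b v) < 0)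

def IsBipartitePermutationGraph {V : Type*} (G : SimpleGraph V) : Prop :=
  IsPermutationGraph G ∧ IsBipartite G

/-- `f : ZMod ℓ → V` is an induced (chordless) cycle of length `ℓ ≥ 3` in `G`:
`f` is injective and two images are adjacent iff their indices are consecutive mod `ℓ`. -/
def IsInducedCycle {V : Type*} (G : SimpleGraph V) (ℓ : ℕ) (f : ZMod ℓ → V) : Prop :=
  3 ≤ ℓ ∧ Function.Injective f ∧
    ∀ i j : ZMod ℓ, G.Adj (f i) (f j) ↔ (i = j + 1 ∨ j = i + 1)

/-- `G` contains `H` as an induced subgraph. -/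
def ContainsInduced {V W : Type*} (G : SimpleGraph V) (H : SimpleGraph W) : Prop :=
  ∃ f : W → V, Function.Injective f ∧ ∀ u v : W, H.Adj u v ↔ G.Adj (f u) (f v)

/-- `G` contains `C_ℓ*`: an induced cycle of length `ℓ` together with a vertex
adjacent to no vertex of the cycle. -/
def HasCycleStar {V : Type*} (G : SimpleGraph V) (ℓ : ℕ) : Prop :=
  ∃ (f : ZMod ℓ → V) (v : V), IsInducedCycle G ℓ f ∧ ∀ i : ZMod ℓ, ¬ G.Adj v (f i)

/-- A maximal clique. -/
def IsMaxClique {V : Type*} (G : SimpleGraph V) (s : Set V) : Prop :=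
  G.IsClique s ∧ ∀ t : Set V, G.IsClique t → s ⊆ t → t = s

/-- A clique path: a linear arrangement of all maximal cliques of `G` such that
the cliques containing any fixed vertex are consecutive. -/
def IsCliquePath {W : Type*} (G : SimpleGraph W) (q : ℕ) (K : Fin q → Set W) : Prop :=
  Function.Injective K ∧ (∀ i, IsMaxClique G (K i)) ∧
    (∀ s : Set W, IsMaxClique G s → ∃ i, K i = s) ∧
    ∀ (v : W) (i j k : Fin q), i ≤ j → j ≤ k → v ∈ K i → v ∈ K k → v ∈ K j

/-- A circular interval of residues mod `n`: `{p, p+1, …, p+m}`. -/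
def IsCircInterval {n : ℕ} (s : Set (ZMod n)) : Prop :=
  ∃ (p : ZMod n) (m : ℕ), s = {x : ZMod n | ∃ k : ℕ, k ≤ m ∧ x = p + (k : ZMod n)}

/-! ### Small named graphs -/

/-- The claw `K_{1,3}`. -/
def clawG : SimpleGraph (Fin 4) := SimpleGraph.fromRel (fun u _ => u = 0)

/-- The net: a triangle `{0,1,2}` with pendant vertices `3,4,5` attached to
`0,1,2` respectively. -/
def netG : SimpleGraph (Fin 6) :=
  SimpleGraph.fromRel (fun u v => (u.val < 3 ∧ v.val < 3) ∨ v.val = u.val + 3)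

/-- The tent `S_3`: triangle `{0,1,2}`, independent set `{3,4,5}`, with
`3 ~ 0,1`, `4 ~ 1,2`, `5 ~ 2,0`. -/
def tentS3 : SimpleGraph (Fin 6) :=
  SimpleGraph.fromRel (fun u v =>
    (u.val < 3 ∧ v.val < 3) ∨ (u = 3 ∧ (v = 0 ∨ v = 1)) ∨
      (u = 4 ∧ (v = 1 ∨ v = 2)) ∨ (u = 5 ∧ (v = 2 ∨ v = 0)))

/-- `S_3*`: the tent together with an isolated vertex `6`. -/
def S3star : SimpleGraph (Fin 7) :=
  SimpleGraph.fromRel (fun u v =>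
    (u.val < 3 ∧ v.val < 3) ∨ (u = 3 ∧ (v = 0 ∨ v = 1)) ∨
      (u = 4 ∧ (v = 1 ∨ v = 2)) ∨ (u = 5 ∧ (v = 2 ∨ v = 0)))

/-- The complement of `S_3*`. -/
def compS3star : SimpleGraph (Fin 7) := S3starᶜ

/-- The complement of `C_4*`: two edges `0-2`, `1-3` plus a universal vertex `4`. -/
def compC4star : SimpleGraph (Fin 5) :=
  SimpleGraph.fromRel (fun u v => (u = 0 ∧ v = 2) ∨ (u = 1 ∧ v = 3) ∨ u = 4)

/-- The chordless cycle `C_6`. -/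
def cycle6G : SimpleGraph (Fin 6) :=
  SimpleGraph.fromRel (fun u v => v.val = (u.val + 1) % 6)

/-- The complement of `C_6`. -/
def compC6 : SimpleGraph (Fin 6) := cycle6Gᶜ

/-- The wheel `W_4`: a `C_4` on `{0,1,2,3}` plus a hub `4`. -/
def W4G : SimpleGraph (Fin 5) :=
  SimpleGraph.fromRel (fun u v => (u.val < 4 ∧ v.val = (u.val + 1) % 4) ∨ v = 4)

/-- The wheel `W_5`: a `C_5` on `{0,…,4}` plus a hub `5`. -/
def W5G : SimpleGraph (Fin 6) :=
  SimpleGraph.fromRel (fun u v => (u.val < 5 ∧ v.val = (u.val + 1) % 5) ∨ v = 5)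

/-- `F_1` (the long claw): the claw with each edge subdivided once. -/
def F1G : SimpleGraph (Fin 7) :=
  SimpleGraph.fromRel (fun u v =>
    (u = 0 ∧ v = 1) ∨ (u = 1 ∧ v = 2) ∨ (u = 0 ∧ v = 3) ∨ (u = 3 ∧ v = 4) ∨
      (u = 0 ∧ v = 5) ∨ (u = 5 ∧ v = 6))

/-- `F_2`: a `C_4` `0-1-2-3-0` with pendant vertices `4,5,6` attached to `0,2,3`. -/
def F2G : SimpleGraph (Fin 7) :=
  SimpleGraph.fromRel (fun u v =>
    (u = 0 ∧ v = 1) ∨ (u = 1 ∧ v = 2) ∨ (u = 2 ∧ v = 3) ∨ (u = 3 ∧ v = 0) ∨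
      (u = 0 ∧ v = 4) ∨ (u = 2 ∧ v = 5) ∨ (u = 3 ∧ v = 6))

/-- `F_3`: a `C_6` `0-1-2-3-4-5-0` with chord `0-3` and pendant `6` at `0`. -/
def F3G : SimpleGraph (Fin 7) :=
  SimpleGraph.fromRel (fun u v =>
    (u.val < 6 ∧ v.val = (u.val + 1) % 6) ∨ (u = 0 ∧ v = 3) ∨ (u = 0 ∧ v = 6))

/-- `F_4`: a `C_6` `0-1-2-3-4-5-0` with chord `0-3` and a vertex `6` adjacent
exactly to `0` and `3`. -/
def F4G : SimpleGraph (Fin 7) :=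
  SimpleGraph.fromRel (fun u v =>
    (u.val < 6 ∧ v.val = (u.val + 1) % 6) ∨ (u = 0 ∧ v = 3) ∨ (u = 6 ∧ (v = 0 ∨ v = 3)))

/-- A reduced graph: connected, co-connected, and containing none of
`C_3*`, `C_5*`, the complement of `C_4*`, `C_6`, `S_3`, the complement of `S_3*`,
`F_1`, `F_2`, `F_3`, `F_4` as induced subgraphs. -/
def IsReducedGraph {V : Type*} (R : SimpleGraph V) : Prop :=
  R.Connected ∧ Rᶜ.Connected ∧
    ¬ HasCycleStar R 3 ∧ ¬ HasCycleStar R 5 ∧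
    ¬ ContainsInduced R compC4star ∧
    ¬ (∃ f : ZMod 6 → V, IsInducedCycle R 6 f) ∧
    ¬ ContainsInduced R tentS3 ∧
    ¬ ContainsInduced R compS3star ∧
    ¬ ContainsInduced R F1G ∧ ¬ ContainsInduced R F2G ∧
    ¬ ContainsInduced R F3G ∧ ¬ ContainsInduced R F4G

theorem circlePt_eq_iff {x y : ℝ} : circlePt x = circlePt y ↔ ∃ n : ℤ, x = y + n := by
  constructor
  · intro h
    rw [circlePt, circlePt, Prod.mk.injEq] at h
    obtain ⟨k, hk⟩ := Real.Angle.angle_eq_iff_two_pi_dvd_sub.1 (Real.Angle.cos_sin_inj h.1 h.2)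
    refine ⟨k, ?_⟩
    have h2 : 2 * Real.pi * (x - (y + k)) = 0 := by linear_combination hk
    rcases mul_eq_zero.1 h2 with h3 | h3
    · exact absurd h3 Real.two_pi_pos.ne'
    · linarith
  · rintro ⟨n, rfl⟩
    have h : 2 * Real.pi * (y + n) = 2 * Real.pi * y + n * (2 * Real.pi) := by ring
    rw [circlePt, circlePt, h, Real.cos_add_int_mul_two_pi, Real.sin_add_int_mul_two_pi]

/-- An arc avoiding a point of the circle lifts to an interval inside a fundamental domain
based at that point. -/
theorem IsUnitCircleArc.exists_lift {A : Set (ℝ × ℝ)} (hA : IsUnitCircleArc A) {t : ℝ}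
    (ht : circlePt t ∉ A) :
    ∃ a b : ℝ, t < a ∧ a ≤ b ∧ b < t + 1 ∧ A = circlePt '' Set.Icc a b := by
  obtain ⟨a, b, hab, -, rfl⟩ := hA
  have hlo := Int.floor_le (a - t)
  have hhi := Int.lt_floor_add_one (a - t)
  set n : ℤ := ⌊a - t⌋
  refine ⟨a - n, b - n, ?_, by linarith, ?_, ?_⟩
  · refine lt_of_le_of_ne (by linarith) fun h => ht ?_
    exact ⟨a, ⟨le_rfl, by linarith⟩, circlePt_eq_iff.2 ⟨n, by linarith⟩⟩
  · by_contra! h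
    refine ht ⟨t + 1 + n, ⟨by linarith, by linarith⟩, circlePt_eq_iff.2 ⟨n + 1, ?_⟩⟩
    push_cast
    ring
  · ext p
    constructor
    · rintro ⟨x, ⟨hx₁, hx₂⟩, rfl⟩
      exact ⟨x - n, ⟨by linarith, by linarith⟩,
        circlePt_eq_iff.2 ⟨-n, by push_cast; ring⟩⟩
    · rintro ⟨x, ⟨hx₁, hx₂⟩, rfl⟩
      exact ⟨x + n, ⟨by linarith, by linarith⟩, circlePt_eq_iff.2 ⟨n, rfl⟩⟩

/-- Two points of the same open fundamental domain have distinct images on the circle. -/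
theorem circlePt_injOn_Ioo (t : ℝ) : Set.InjOn circlePt (Set.Ioo t (t + 1)) := by
  rintro x ⟨hx₁, hx₂⟩ y ⟨hy₁, hy₂⟩ h
  obtain ⟨n, hn⟩ := circlePt_eq_iff.1 h
  have h₁ : (n : ℝ) < 1 := by linarith
  have h₂ : (-1 : ℝ) < n := by linarith
  have h₃ : n < 1 := by exact_mod_cast h₁
  have h₄ : -1 < n := by exact_mod_cast h₂
  obtain rfl : n = 0 := by omega
  simpa using hn

theorem ZMod.natCast_ne_zero_of_pos_of_lt {ℓ k : ℕ} (hk : 0 < k) (hkl : k < ℓ) :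
    (k : ZMod ℓ) ≠ 0 := fun h =>
  absurd (Nat.le_of_dvd hk ((ZMod.natCast_eq_zero_iff k ℓ).1 h)) (not_le.2 hkl)

/-- In an arc representation, the arcs of a hole cover the circle. -/
theorem IsArcRep.exists_circlePt_mem_of_hole {V : Type*} {G : SimpleGraph V}
    {A : V → Set (ℝ × ℝ)} (hA : IsArcRep G A) {ℓ : ℕ} {f : ZMod ℓ → V} (hl : 4 ≤ ℓ)
    (hf : IsInducedCycle G ℓ f) (t : ℝ) : ∃ i, circlePt t ∈ A (f i) := by
  by_contra! hcon
  have : NeZero ℓ := ⟨by omega⟩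
  choose a b hta hab hbt hAab using fun i => (hA.1 (f i)).exists_lift (hcon i)
  obtain ⟨i, hi⟩ := Finite.exists_min b
  have key (j : ZMod ℓ) (h : G.Adj (f i) (f j)) : circlePt (b i) ∈ A (f j) := by
    obtain ⟨p, hp₁, hp₂⟩ := (hA.2 _ _ h.ne).1 h
    rw [hAab] at hp₁ hp₂
    obtain ⟨x, hx, rfl⟩ := hp₁
    obtain ⟨y, hy, hyx⟩ := hp₂
    have hxy : y = x := circlePt_injOn_Ioo t
      ⟨(hta j).trans_le hy.1, hy.2.trans_lt (hbt j)⟩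
      ⟨(hta i).trans_le hx.1, hx.2.trans_lt (hbt i)⟩ hyx
    subst hxy
    rw [hAab]
    exact ⟨b i, ⟨hy.1.trans hx.2, hi j⟩, rfl⟩
  have h₁ := key (i + 1) ((hf.2.2 _ _).2 (Or.inr rfl))
  have h₂ := key (i - 1) ((hf.2.2 _ _).2 (Or.inl (by ring)))
  have two_ne : (2 : ZMod ℓ) ≠ 0 := by
    exact_mod_cast ZMod.natCast_ne_zero_of_pos_of_lt (ℓ := ℓ) (k := 2) (by omega) (by omega)
  have one_ne : (1 : ZMod ℓ) ≠ 0 := by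
    exact_mod_cast ZMod.natCast_ne_zero_of_pos_of_lt (ℓ := ℓ) (k := 1) (by omega) (by omega)
  have three_ne : (3 : ZMod ℓ) ≠ 0 := by
    exact_mod_cast ZMod.natCast_ne_zero_of_pos_of_lt (ℓ := ℓ) (k := 3) (by omega) (by omega)
  have hne : f (i + 1) ≠ f (i - 1) := fun h => two_ne (by linear_combination hf.2.1 h)
  rcases (hf.2.2 _ _).1 ((hA.2 _ _ hne).2 ⟨_, h₁, h₂⟩) with h | h
  · exact one_ne (by linear_combination h)
  · exact three_ne (by linear_combination -h)

/-- Every vertex of a proper Helly circular-arc graph has at least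
two neighbors on any hole (induced cycle of length at least 4). -/
theorem phcag_hole_dominating {V : Type*} [Fintype V] (G : SimpleGraph V)
    (hG : IsProperHellyCircularArcGraph G)
    (ℓ : ℕ) (f : ZMod ℓ → V) (hl : 4 ≤ ℓ) (hf : IsInducedCycle G ℓ f) :
    ∀ v : V, ∃ i j : ZMod ℓ, i ≠ j ∧ G.Adj v (f i) ∧ G.Adj v (f j) := by
  obtain ⟨A, hA, hproper, -⟩ := hG
  intro v
  have two_ne : (2 : ZMod ℓ) ≠ 0 := by
    exact_mod_cast ZMod.natCast_ne_zero_of_pos_of_lt (ℓ := ℓ) (k := 2) (by omega) (by omega)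
  by_cases hv : ∃ i, f i = v
  · obtain ⟨i, rfl⟩ := hv
    exact ⟨i + 1, i - 1, fun h => two_ne (by linear_combination h),
      (hf.2.2 _ _).2 (Or.inr rfl), (hf.2.2 _ _).2 (Or.inl (by ring))⟩
  push Not at hv
  by_contra! hcon
  have adj_of_mem {p : ℝ × ℝ} {j : ZMod ℓ} (hp : p ∈ A v) (hj : p ∈ A (f j)) :
      G.Adj v (f j) := (hA.2 _ _ (hv j).symm).2 ⟨p, hp, hj⟩
  have covered {p : ℝ × ℝ} (hp : p ∈ A v) : ∃ j, p ∈ A (f j) := by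
    obtain ⟨a, b, -, -, hab⟩ := hA.1 v
    obtain ⟨x, -, rfl⟩ := hab ▸ hp
    exact hA.exists_circlePt_mem_of_hole hl hf x
  obtain ⟨i, hi⟩ : ∃ i, G.Adj v (f i) := by
    obtain ⟨a, b, hab, -, hAv⟩ := hA.1 v
    have hp : circlePt a ∈ A v := hAv ▸ ⟨a, ⟨le_rfl, by linarith⟩, rfl⟩
    obtain ⟨j, hj⟩ := covered hp
    exact ⟨j, adj_of_mem hp hj⟩
  have unique {j : ZMod ℓ} (hj : G.Adj v (f j)) : i = j := by
    by_contra h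
    exact hcon i j h hi hj
  refine hproper v (f i) ⟨fun p hp => ?_, fun hsub => ?_⟩
  · obtain ⟨j, hj⟩ := covered hp
    exact unique (adj_of_mem hp hj) ▸ hj
  · have hadj : G.Adj (f i) (f (i + 1)) := (hf.2.2 _ _).2 (Or.inr rfl)
    obtain ⟨p, hp, hp'⟩ := (hA.2 _ _ hadj.ne).1 hadj
    exact hadj.ne (congrArg f (unique (adj_of_mem (hsub hp) hp')))
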